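/- Let d ≥ 1 and assume Assumptions (U) and (G1). There exists ε₀ ∈ (0,1) such that for every ε ∈ (0,ε₀) there exists a constant κ₁ > 0 such that the function V₁(q,p) = H(q,p)² + ε⟨q,p⟩ − ⟨q,p⟩/|q| + κ₁ satisfies V₁(q,p) ≥ 1 for all (q,p) ∈ (ℝ^d ∖ {0}) × ℝ^d, and for every integer n ≥ 1 there exist constants c = c(n,ε) > 0 and C = C(n,ε) > 0 such that L₁(V₁ⁿ)(q,p) ≤ −c·V₁(q,p)^{n−1/2} + C for all (q,p) ∈ (ℝ^d ∖ {0}) × ℝ^d. (Lemma 3.1) -/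

import Mathlib

open scoped RealInnerProductSpace

/-- The single-particle generator `L₁` of the relativistic Langevin dynamics:
`L₁φ = ⟨p/√(1+ε|p|²), ∇_q φ⟩ + ⟨−p/√(1+ε|p|²) − ∇U(q) − ∇G(q), ∇_p φ⟩ + Δ_p φ`. -/
noncomputable def L1 {d : ℕ} (ε : ℝ) (U G : EuclideanSpace ℝ (Fin d) → ℝ)
    (φ : EuclideanSpace ℝ (Fin d) → EuclideanSpace ℝ (Fin d) → ℝ)
    (q p : EuclideanSpace ℝ (Fin d)) : ℝ :=
  ⟪(Real.sqrt (1 + ε * ‖p‖ ^ 2))⁻¹ • p, gradient (fun q' => φ q' p) q⟫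
    + ⟪-((Real.sqrt (1 + ε * ‖p‖ ^ 2))⁻¹ • p) - gradient U q - gradient G q,
        gradient (fun p' => φ q p') p⟫
    + ∑ i : Fin d,
        fderiv ℝ (fun p' => fderiv ℝ (fun p'' => φ q p'') p' (EuclideanSpace.single i 1))
          p (EuclideanSpace.single i 1)

/-- The single-particle Hamiltonian `H(q,p) = εU(q) + εG(q) + √(1+ε|p|²)`. -/
noncomputable def H1 {d : ℕ} (ε : ℝ) (U G : EuclideanSpace ℝ (Fin d) → ℝ)
    (q p : EuclideanSpace ℝ (Fin d)) : ℝ :=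
  ε * U q + ε * G q + Real.sqrt (1 + ε * ‖p‖ ^ 2)

/-- The Lyapunov candidate `V₁(q,p) = H(q,p)² + ε⟨q,p⟩ − ⟨q,p⟩/|q| + κ₁`. -/
noncomputable def V1 {d : ℕ} (ε κ₁ : ℝ) (U G : EuclideanSpace ℝ (Fin d) → ℝ)
    (q p : EuclideanSpace ℝ (Fin d)) : ℝ :=
  (H1 ε U G q p) ^ 2 + ε * ⟪q, p⟫ - ⟪q, p⟫ / ‖q‖ + κ₁

section Calculus

variable {E : Type*} [NormedAddCommGroup E] [InnerProductSpace ℝ E]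

theorem HasFDerivAt.div_real {f g : E → ℝ} {f' g' : E →L[ℝ] ℝ} {x : E}
    (hf : HasFDerivAt f f' x) (hg : HasFDerivAt g g' x) (hx : g x ≠ 0) :
    HasFDerivAt (fun y => f y / g y) ((g x)⁻¹ • f' - (f x / g x ^ 2) • g') x := by
  refine (hf.mul ((hasDerivAt_inv hx).comp_hasFDerivAt x hg)).congr_fderiv ?_
  ext v
  simp
  ring

theorem hasFDerivAt_inner_left (q p : E) :
    HasFDerivAt (fun q' : E => ⟪q', p⟫) (innerSL ℝ p) q := by
  refine (innerSL ℝ p).hasFDerivAt.congr_of_eventuallyEq ?_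
  filter_upwards with q'
  simp [real_inner_comm]

theorem fderiv_fderiv_pow {f : E → ℝ} (hf : ContDiff ℝ 2 f) (n : ℕ) (x v : E) :
    fderiv ℝ (fun y => fderiv ℝ (fun z => f z ^ n) y v) x v
      = n * f x ^ (n - 1) * fderiv ℝ (fun y => fderiv ℝ f y v) x v
        + n * ((n - 1 : ℕ) * f x ^ (n - 1 - 1)) * fderiv ℝ f x v ^ 2 := by
  have hd : Differentiable ℝ f := hf.differentiable (by norm_num)
  have hd' : Differentiable ℝ (fun y => fderiv ℝ f y v) :=
    ((hf.fderiv_right (m := 1) (by norm_num)).differentiable (by norm_num)).clm_apply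
      (differentiable_const v)
  have h1 : (fun y => fderiv ℝ (fun z => f z ^ n) y v)
      = fun y => (n * f y ^ (n - 1)) * fderiv ℝ f y v := by
    funext y
    rw [((hd y).hasFDerivAt.pow n).fderiv]
    simp
  have h2 := (((hd x).hasFDerivAt.pow (n - 1)).const_mul (n : ℝ)).mul (hd' x).hasFDerivAt
  rw [h1]
  erw [h2.fderiv]
  simp
  ring

theorem hasFDerivAt_sqrt_one_add {ε : ℝ} (hε : 0 ≤ ε) (p : E) :
    HasFDerivAt (fun p' : E => √(1 + ε * ‖p'‖ ^ 2))
      ((ε / √(1 + ε * ‖p‖ ^ 2)) • innerSL ℝ p) p := by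
  have h := (((hasStrictFDerivAt_norm_sq p).hasFDerivAt.const_mul ε).const_add 1).sqrt
    (by positivity)
  refine h.congr_fderiv ?_
  ext v
  simp
  ring

theorem hasFDerivAt_inner_div_norm {q : E} (hq : q ≠ 0) (p : E) :
    HasFDerivAt (fun q' : E => ⟪q', p⟫ / ‖q'‖)
      (‖q‖⁻¹ • innerSL ℝ p - (⟪q, p⟫ / ‖q‖ ^ 3) • innerSL ℝ q) q := by
  have hn : ‖q‖ ≠ 0 := norm_ne_zero_iff.mpr hq
  have h1 : HasFDerivAt (fun q' : E => ‖q'‖) (‖q‖⁻¹ • innerSL ℝ q) q := by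
    have h := (hasStrictFDerivAt_norm_sq q).hasFDerivAt.sqrt (by positivity)
    simp only [Real.sqrt_sq (norm_nonneg _)] at h
    refine h.congr_fderiv ?_
    ext v
    simp
    ring
  have h2 := hasFDerivAt_inner_left q p
  refine (h2.div_real h1 hn).congr_fderiv ?_
  ext v
  simp
  field_simp

end Calculus

theorem L1_pow {d : ℕ} (ε : ℝ) (U G : EuclideanSpace ℝ (Fin d) → ℝ)
    (φ : EuclideanSpace ℝ (Fin d) → EuclideanSpace ℝ (Fin d) → ℝ)
    (q p : EuclideanSpace ℝ (Fin d)) (hφq : DifferentiableAt ℝ (fun q' => φ q' p) q)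
    (hφp : ContDiff ℝ 2 (φ q)) (n : ℕ) :
    L1 ε U G (fun q' p' => φ q' p' ^ n) q p
      = n * φ q p ^ (n - 1) * L1 ε U G φ q p
        + n * ((n - 1 : ℕ) * φ q p ^ (n - 1 - 1))
          * ∑ i : Fin d, fderiv ℝ (φ q) p (EuclideanSpace.single i 1) ^ 2 := by
  have hd : Differentiable ℝ (φ q) := hφp.differentiable (by norm_num)
  simp only [L1, inner_gradient_right, conj_trivial, fderiv_fderiv_pow hφp n]
  rw [(hφq.hasFDerivAt.pow n).fderiv, ((hd p).hasFDerivAt.pow n).fderiv,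
    Finset.sum_add_distrib, ← Finset.mul_sum, ← Finset.mul_sum]
  simp
  ring

/-- `V₁` as a function of the momentum, with the square expanded. -/
theorem V1_eq {d : ℕ} {ε : ℝ} (hε : 0 ≤ ε) (κ₁ : ℝ) (U G : EuclideanSpace ℝ (Fin d) → ℝ)
    (q p : EuclideanSpace ℝ (Fin d)) :
    V1 ε κ₁ U G q p = 2 * (ε * U q + ε * G q) * √(1 + ε * ‖p‖ ^ 2) + ε * ‖p‖ ^ 2
      + ⟪(ε - ‖q‖⁻¹) • q, p⟫ + ((ε * U q + ε * G q) ^ 2 + 1 + κ₁) := by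
  have hs : √(1 + ε * ‖p‖ ^ 2) ^ 2 = 1 + ε * ‖p‖ ^ 2 := Real.sq_sqrt (by positivity)
  simp only [V1, H1, real_inner_smul_left]
  linear_combination hs

section V1Calculus

variable {d : ℕ} {ε : ℝ} (κ₁ : ℝ) (U G : EuclideanSpace ℝ (Fin d) → ℝ)
  (q p : EuclideanSpace ℝ (Fin d))

theorem contDiff_V1_momentum (hε : 0 ≤ ε) : ContDiff ℝ 2 (V1 ε κ₁ U G q) := by
  rw [funext (V1_eq hε κ₁ U G q)]
  have h : ContDiff ℝ 2 (fun p : EuclideanSpace ℝ (Fin d) => √(1 + ε * ‖p‖ ^ 2)) :=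
    ContDiff.sqrt (contDiff_const.add (contDiff_const.mul (contDiff_norm_sq ℝ)))
      (fun x => by positivity)
  have h2 : ContDiff ℝ 2 (fun p : EuclideanSpace ℝ (Fin d) => ‖p‖ ^ 2) := contDiff_norm_sq ℝ
  have h3 : ContDiff ℝ 2 (fun p : EuclideanSpace ℝ (Fin d) => ⟪(ε - ‖q‖⁻¹) • q, p⟫) :=
    contDiff_const.inner ℝ contDiff_id
  exact (((contDiff_const.mul h).add (contDiff_const.mul h2)).add h3).add contDiff_const

theorem fderiv_V1_momentum (hε : 0 ≤ ε) (v : EuclideanSpace ℝ (Fin d)) :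
    fderiv ℝ (V1 ε κ₁ U G q) p v
      = 2 * ε * (ε * U q + ε * G q) * (⟪p, v⟫ / √(1 + ε * ‖p‖ ^ 2)) + 2 * ε * ⟪p, v⟫
        + ⟪(ε - ‖q‖⁻¹) • q, v⟫ := by
  rw [funext (V1_eq hε κ₁ U G q)]
  have h := ((((hasFDerivAt_sqrt_one_add hε p).const_mul (2 * (ε * U q + ε * G q))).add
    ((hasStrictFDerivAt_norm_sq p).hasFDerivAt.const_mul ε)).add
    (innerSL ℝ ((ε - ‖q‖⁻¹) • q)).hasFDerivAt).add_const ((ε * U q + ε * G q) ^ 2 + 1 + κ₁)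
  erw [h.fderiv]
  simp [real_inner_smul_left]
  ring

theorem fderiv_fderiv_V1_momentum (hε : 0 ≤ ε) (v : EuclideanSpace ℝ (Fin d)) :
    fderiv ℝ (fun p' => fderiv ℝ (V1 ε κ₁ U G q) p' v) p v
      = 2 * ε * (ε * U q + ε * G q) * (‖v‖ ^ 2 / √(1 + ε * ‖p‖ ^ 2)
          - ε * ⟪p, v⟫ ^ 2 / √(1 + ε * ‖p‖ ^ 2) ^ 3) + 2 * ε * ‖v‖ ^ 2 := by
  rw [funext (fun p' => fderiv_V1_momentum κ₁ U G q p' hε v)]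
  have hs : √(1 + ε * ‖p‖ ^ 2) ≠ 0 := (Real.sqrt_pos.mpr (by positivity)).ne'
  have h2 := hasFDerivAt_inner_left p v
  have h := (((h2.div_real (hasFDerivAt_sqrt_one_add hε p) hs).const_mul
    (2 * ε * (ε * U q + ε * G q))).add (h2.const_mul (2 * ε))).add_const ⟪(ε - ‖q‖⁻¹) • q, v⟫
  erw [h.fderiv]
  simp
  field_simp
  simp

theorem hasFDerivAt_V1_position {q : EuclideanSpace ℝ (Fin d)} (hq : q ≠ 0)
    (hU : DifferentiableAt ℝ U q) (hG : DifferentiableAt ℝ G q) :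
    HasFDerivAt (fun q' => V1 ε κ₁ U G q' p)
      ((2 * H1 ε U G q p) • (ε • fderiv ℝ U q + ε • fderiv ℝ G q) + ε • innerSL ℝ p
        - (‖q‖⁻¹ • innerSL ℝ p - (⟪q, p⟫ / ‖q‖ ^ 3) • innerSL ℝ q)) q := by
  have h2 := hasFDerivAt_inner_left q p
  have h := ((((((hU.hasFDerivAt.const_mul ε).add (hG.hasFDerivAt.const_mul ε)).add_const
    (√(1 + ε * ‖p‖ ^ 2))).pow 2).add (h2.const_mul ε)).sub
    (hasFDerivAt_inner_div_norm hq p)).add_const κ₁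
  refine h.congr_fderiv ?_
  ext v
  simp [H1]
  ring

theorem L1_V1 {q : EuclideanSpace ℝ (Fin d)} (hε : 0 ≤ ε) (hq : q ≠ 0)
    (hU : DifferentiableAt ℝ U q) (hG : DifferentiableAt ℝ G q) {s x : ℝ}
    (hs : s = √(1 + ε * ‖p‖ ^ 2)) (hx : x = ε * U q + ε * G q) :
    L1 ε U G (V1 ε κ₁ U G) q p
      = ε * ‖p‖ ^ 2 / s - (‖p‖ ^ 2 / ‖q‖ - ⟪q, p⟫ ^ 2 / ‖q‖ ^ 3) / s
        - 2 * ε * (x + s) * ‖p‖ ^ 2 / s ^ 2 - ε * ⟪q, p⟫ / s + ⟪q, p⟫ / ‖q‖ / s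
        - (ε - ‖q‖⁻¹) * (⟪gradient U q, q⟫ + ⟪gradient G q, q⟫)
        + 2 * ε * x * (d / s - ε * ‖p‖ ^ 2 / s ^ 3) + 2 * ε * d := by
  have hs0 : 0 < s := by rw [hs]; exact Real.sqrt_pos.mpr (by positivity)
  have hn : ‖q‖ ≠ 0 := norm_ne_zero_iff.mpr hq
  have hsum : ∑ i : Fin d, ⟪p, EuclideanSpace.single i 1⟫ ^ 2 = ‖p‖ ^ 2 := by
    simp [EuclideanSpace.real_norm_sq_eq, EuclideanSpace.inner_single_right]
  simp only [L1, inner_gradient_right, conj_trivial, fderiv_fderiv_V1_momentum κ₁ U G q p hε]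
  rw [Finset.sum_add_distrib, ← Finset.mul_sum, Finset.sum_sub_distrib, ← Finset.sum_div,
    ← Finset.sum_div, ← Finset.mul_sum, hsum, fderiv_V1_momentum κ₁ U G q p hε,
    (hasFDerivAt_V1_position κ₁ U G p hq hU hG).fderiv]
  simp only [H1, ← hs, ← hx]
  simp [inner_sub_right, real_inner_smul_right, real_inner_comm]
  field_simp
  ring

end V1Calculus

section Scalar

theorem exists_rpow_le_of_one_le {t b η : ℝ} (htb : t < b) (hη : 0 < η) :
    ∃ C : ℝ, 0 ≤ C ∧ ∀ r : ℝ, 1 ≤ r → r ^ t ≤ η * r ^ b + C := by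
  refine ⟨((η⁻¹) ^ (b - t)⁻¹) ^ |t|, by positivity, fun r hr => ?_⟩
  have hr0 : 0 < r := by linarith
  have hbt : 0 < b - t := sub_pos.mpr htb
  rcases le_or_gt (η⁻¹) (r ^ (b - t)) with h | h
  · have h1 : 1 ≤ η * r ^ (b - t) := by
      rwa [inv_le_iff_one_le_mul₀' hη] at h
    have h2 : r ^ b = r ^ (b - t) * r ^ t := by
      rw [← Real.rpow_add hr0]; ring_nf
    have h3 : 1 * r ^ t ≤ (η * r ^ (b - t)) * r ^ t := by gcongr
    have h4 : 0 ≤ ((η⁻¹) ^ (b - t)⁻¹) ^ |t| := by positivity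
    rw [h2]
    linarith
  · have h1 : r ≤ (η⁻¹) ^ (b - t)⁻¹ := by
      calc r = (r ^ (b - t)) ^ (b - t)⁻¹ := by
            rw [← Real.rpow_mul hr0.le, mul_inv_cancel₀ hbt.ne', Real.rpow_one]
        _ ≤ _ := by gcongr
    have h2 : r ^ t ≤ r ^ |t| := Real.rpow_le_rpow_of_exponent_le hr (le_abs_self t)
    have h3 : r ^ |t| ≤ ((η⁻¹) ^ (b - t)⁻¹) ^ |t| := by gcongr
    have h4 : 0 ≤ η * r ^ b := by positivity
    linarith

/-- A power is dominated by any larger power at infinity and any smaller power at zero. -/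
theorem exists_rpow_le {a t b η : ℝ} (hat : a < t) (htb : t < b) (hη : 0 < η) :
    ∃ C : ℝ, 0 ≤ C ∧ ∀ r : ℝ, 0 < r → r ^ t ≤ η * (r ^ b + r ^ a) + C := by
  obtain ⟨C₁, hC₁, h₁⟩ := exists_rpow_le_of_one_le htb hη
  obtain ⟨C₂, hC₂, h₂⟩ := exists_rpow_le_of_one_le (neg_lt_neg hat) hη
  refine ⟨C₁ + C₂, by positivity, fun r hr => ?_⟩
  have ha : 0 ≤ η * r ^ a := by positivity
  have hb : 0 ≤ η * r ^ b := by positivity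
  rcases le_total 1 r with h | h
  · linarith [h₁ r h]
  · have := h₂ r⁻¹ ((one_le_inv₀ hr).mpr h)
    rw [Real.inv_rpow hr.le, Real.inv_rpow hr.le, Real.rpow_neg hr.le, Real.rpow_neg hr.le,
      inv_inv, inv_inv] at this
    linarith

theorem dissipation_of_interpolation {a₁ a₂ a₄ b ε D δ M c r A B L Q s x K C₁ C₂ C₃ C₄ : ℝ}
    (ha₁ : 0 < a₁) (hb : 0 ≤ b) (hC₁ : 0 ≤ C₁) (hε : 0 < ε) (hε1 : ε ≤ 1) (hD : 0 ≤ D)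
    (h₂ : 4 * D * a₁ * ε ≤ a₂) (h₄ : 4 * D * a₁ * ε ≤ a₄)
    (hδ0 : 0 < δ) (hδ : δ = min (ε * a₂) a₄) (hM : M = 1 + δ + a₁ + b)
    (hc0 : 0 ≤ c) (hc1 : c ≤ 1) (hcδ : c * a₁ ≤ δ / 8)
    (hr : 0 < r) (hA : 0 < A) (hB : 0 < B) (hL : 0 < L) (hQ : 0 < Q) (hs : 1 ≤ s)
    (hxle : x ≤ ε * (a₁ * (1 + A) + a₁ * (1 + r + B)))
    (b₁ : r ≤ δ / (16 * M) * (A + B) + C₁) (b₂ : L ≤ δ / (16 * M) * (A + B) + C₂)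
    (b₃ : r * B ≤ δ / (16 * M) * (A + B) + C₃) (b₄ : Q ≤ δ / (16 * M) * (A + B) + C₄) :
    -s + 2 * ε * D * x + r + a₁ * L + ε * (a₁ * (r * (1 + B)))
        + b * Q - ε * a₂ * A - a₄ * B + K
      ≤ -c * (x + s) + (|K| + δ + M * (C₁ + C₂ + C₃ + C₄) + a₁ * (2 + C₁) + 1) := by
  have hM0 : 0 < M := by rw [hM]; positivity
  have hMη : M * (δ / (16 * M)) = δ / 16 := by field_simp
  have key : ∀ m y C : ℝ, 0 ≤ y → m ≤ M → y ≤ δ / (16 * M) * (A + B) + C →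
      m * y ≤ δ / 16 * (A + B) + M * C := by
    intro m y C hy hm h
    calc m * y ≤ M * y := by gcongr
      _ ≤ M * (δ / (16 * M) * (A + B) + C) := by gcongr
      _ = M * (δ / (16 * M)) * (A + B) + M * C := by ring
      _ = _ := by rw [hMη]
  have k₁ := key (1 + δ / 2 + a₁) r C₁ hr.le (by linarith) b₁
  have k₂ := key a₁ _ C₂ hL.le (by linarith) b₂
  have k₃ := key a₁ _ C₃ (by positivity) (by linarith) b₃
  have k₄ := key b _ C₄ hQ.le (by linarith) b₄
  have e1 : 2 * ε * D * x ≤ δ / 2 * (2 + r + A + B) := by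
    have e2 : 2 * ε * D * (ε * a₁) ≤ δ / 2 := by
      have h2 := mul_le_mul_of_nonneg_left h₂ hε.le
      have h4 : ε * (4 * D * a₁ * ε) ≤ 1 * (4 * D * a₁ * ε) := by gcongr
      have h5 : 4 * ε * D * (ε * a₁) ≤ δ := by
        rw [hδ]
        exact le_min (by linarith) (by linarith)
      linarith
    calc 2 * ε * D * x ≤ 2 * ε * D * (ε * (a₁ * (1 + A) + a₁ * (1 + r + B))) := by gcongr
      _ = 2 * ε * D * (ε * a₁) * (2 + r + A + B) := by ring
      _ ≤ _ := by gcongr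
  have e3 : ε * (a₁ * (r * (1 + B))) ≤ a₁ * r + a₁ * (r * B) := by
    calc ε * (a₁ * (r * (1 + B))) ≤ 1 * (a₁ * (r * (1 + B))) := by gcongr
      _ = _ := by ring
  have e4 : δ * A + δ * B ≤ ε * a₂ * A + a₄ * B := by
    have h1 : δ ≤ ε * a₂ := hδ ▸ min_le_left _ _
    have h2 : δ ≤ a₄ := hδ ▸ min_le_right _ _
    gcongr
  have e5 : c * x ≤ δ / 4 * (A + B) + a₁ * (2 + C₁) := by
    have h1 : δ / (16 * M) ≤ 1 := by
      rw [div_le_one (by positivity)]; linarith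
    have h2 : r ≤ 1 * (A + B) + C₁ := b₁.trans (by gcongr)
    have h3 : x ≤ a₁ * (2 + C₁ + 2 * (A + B)) := by
      calc x ≤ ε * (a₁ * (1 + A) + a₁ * (1 + r + B)) := hxle
        _ ≤ 1 * (a₁ * (1 + A) + a₁ * (1 + r + B)) := by gcongr
        _ = a₁ * (2 + r + (A + B)) := by ring
        _ ≤ a₁ * (2 + C₁ + 2 * (A + B)) := by gcongr ?_ * ?_; linarith
    calc c * x ≤ c * (a₁ * (2 + C₁ + 2 * (A + B))) := by gcongr
      _ = c * (a₁ * (2 + C₁)) + 2 * (c * a₁) * (A + B) := by ring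
      _ ≤ 1 * (a₁ * (2 + C₁)) + 2 * (δ / 8) * (A + B) := by gcongr
      _ = _ := by ring
  have e6 : c * s ≤ s := mul_le_of_le_one_left (by linarith) hc1
  have e7 := le_abs_self K
  linarith

theorem exists_dissipation {a₁ lam a₂ a₄ β₁ β₂ ε D : ℝ} (a₅ K : ℝ) (ha₁ : 0 < a₁)
    (hlam : 1 ≤ lam) (ha₂ : 0 < a₂) (hβ₁ : 1 ≤ β₁) (hβ₂0 : 0 ≤ β₂) (hβ₂1 : β₂ < β₁)
    (ha₄ : 0 < a₄) (hε : 0 < ε) (hε1 : ε ≤ 1) (hD : 0 ≤ D)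
    (h₂ : 4 * D * a₁ * ε ≤ a₂) (h₄ : 4 * D * a₁ * ε ≤ a₄) :
    ∃ c C : ℝ, 0 < c ∧ 0 < C ∧ ∀ r s x : ℝ, 0 < r → 1 ≤ s →
      x ≤ ε * (a₁ * (1 + r ^ (lam + 1)) + a₁ * (1 + r + r ^ (-β₁))) →
      -s + 2 * ε * D * x + r + a₁ * r ^ lam + ε * (a₁ * (r * (1 + r ^ (-β₁))))
        + |a₅| * r ^ (-β₂) - ε * a₂ * r ^ (lam + 1) - a₄ * r ^ (-β₁) + K ≤ -c * (x + s) + C := by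
  obtain ⟨δ, hδ⟩ : ∃ δ, δ = min (ε * a₂) a₄ := ⟨_, rfl⟩
  have hδ0 : 0 < δ := hδ ▸ lt_min (by positivity) ha₄
  obtain ⟨M, hM⟩ : ∃ M, M = 1 + δ + a₁ + |a₅| := ⟨_, rfl⟩
  have hM0 : 0 < M := by rw [hM]; positivity
  have hη : 0 < δ / (16 * M) := by positivity
  obtain ⟨C₁, hC₁, b₁⟩ := exists_rpow_le (a := -β₁) (t := 1) (b := lam + 1)
    (by linarith) (by linarith) hη
  obtain ⟨C₂, hC₂, b₂⟩ := exists_rpow_le (a := -β₁) (t := lam) (b := lam + 1)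
    (by linarith) (by linarith) hη
  obtain ⟨C₃, hC₃, b₃⟩ := exists_rpow_le (a := -β₁) (t := 1 + -β₁) (b := lam + 1)
    (by linarith) (by linarith) hη
  obtain ⟨C₄, hC₄, b₄⟩ := exists_rpow_le (a := -β₁) (t := -β₂) (b := lam + 1)
    (by linarith) (by linarith) hη
  have hc0 : 0 < min 1 (δ / (8 * a₁)) := lt_min one_pos (by positivity)
  refine ⟨min 1 (δ / (8 * a₁)),
    |K| + δ + M * (C₁ + C₂ + C₃ + C₄) + a₁ * (2 + C₁) + 1, hc0, by positivity, ?_⟩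
  intro r s x hr hs hxle
  have hcδ : min 1 (δ / (8 * a₁)) * a₁ ≤ δ / 8 := by
    calc min 1 (δ / (8 * a₁)) * a₁ ≤ δ / (8 * a₁) * a₁ := by gcongr; exact min_le_right _ _
      _ = δ / 8 := by field_simp
  specialize b₁ r hr
  specialize b₃ r hr
  rw [Real.rpow_add hr 1, Real.rpow_one] at b₃
  rw [Real.rpow_one] at b₁
  exact dissipation_of_interpolation ha₁ (abs_nonneg a₅) hC₁ hε hε1 hD h₂ h₄ hδ0 hδ hM hc0.le
    (min_le_left _ _) hcδ hr (by positivity) (by positivity) (by positivity) (by positivity) hs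
    hxle b₁ (b₂ r hr) b₃ (b₄ r hr)

theorem drift_le {ε P r s x i u g D : ℝ} (hε : 0 < ε) (hr : 0 < r)
    (hs : 1 ≤ s) (hs2 : s ^ 2 = 1 + ε * P ^ 2) (hx : 0 ≤ x) (hD : 0 ≤ D)
    (hi : |i| ≤ r * P) (hPs : ε * P ≤ s) :
    ε * P ^ 2 / s - (P ^ 2 / r - i ^ 2 / r ^ 3) / s
        - 2 * ε * (x + s) * P ^ 2 / s ^ 2 - ε * i / s + i / r / s
        - (ε - r⁻¹) * (u + g)
        + 2 * ε * x * (D / s - ε * P ^ 2 / s ^ 3) + 2 * ε * D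
      ≤ -s + 1 + 2 * ε * D + 2 * ε * D * x + r + 1 / ε - ε * u - ε * g + (u / r + g / r) := by
  have hs0 : 0 < s := by linarith
  obtain ⟨hi1, hi2⟩ := abs_le.mp hi
  have t1 : ε * P ^ 2 / s - 2 * ε * (x + s) * P ^ 2 / s ^ 2 ≤ -s + 1 := by
    have h0 : ε * P ^ 2 / s - 2 * ε * (x + s) * P ^ 2 / s ^ 2
        = -(ε * P ^ 2 / s) - 2 * x * (ε * P ^ 2) / s ^ 2 := by field_simp; ring
    have h1 : ε * P ^ 2 / s = s - 1 / s := by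
      field_simp; linarith
    have h2 : 1 / s ≤ 1 := by rw [div_le_one hs0]; exact hs
    have h3 : 0 ≤ 2 * x * (ε * P ^ 2) / s ^ 2 := by positivity
    rw [h0, h1]
    linarith
  have t2 : 0 ≤ (P ^ 2 / r - i ^ 2 / r ^ 3) / s := by
    have h1 : i ^ 2 ≤ (r * P) ^ 2 := sq_le_sq' hi1 hi2
    have h2 : P ^ 2 / r - i ^ 2 / r ^ 3 = ((r * P) ^ 2 - i ^ 2) / r ^ 3 := by
      field_simp
    rw [h2]
    exact div_nonneg (div_nonneg (by linarith) (by positivity)) hs0.le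
  have t3 : -(ε * i / s) ≤ r := by
    rw [← neg_div, div_le_iff₀ hs0]
    nlinarith
  have t4 : i / r / s ≤ 1 / ε := by
    rw [div_div, div_le_div_iff₀ (by positivity) hε]
    nlinarith
  have t5 : 2 * ε * x * (D / s - ε * P ^ 2 / s ^ 3) ≤ 2 * ε * D * x := by
    have h1 : D / s ≤ D := div_le_self hD hs
    have h2 : 0 ≤ ε * P ^ 2 / s ^ 3 := by positivity
    calc _ ≤ 2 * ε * x * D := by gcongr; linarith
      _ = _ := by ring
  have t6 : (ε - r⁻¹) * (u + g) = ε * u + ε * g - (u / r + g / r) := by field_simp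
  linarith

theorem cross_term_le {ε P r s x i C₀ : ℝ} (hε : 0 < ε) (hr : 0 < r) (hs : 1 ≤ s)
    (hi : |i| ≤ r * P) (hPs : ε * P ≤ s) (hrx : r ≤ x + C₀) :
    |ε * i - i / r| ≤ (x + s) ^ 2 / 2 + (C₀ ^ 2 + (1 / ε) ^ 2) := by
  have h1 : |ε * i| ≤ (x + C₀) * s := by
    rw [abs_mul, abs_of_pos hε]
    nlinarith
  have h2 : |i / r| ≤ 1 / ε * s := by
    rw [abs_div, abs_of_pos hr, div_le_iff₀ hr, div_mul_eq_mul_div, div_mul_eq_mul_div,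
      le_div_iff₀ hε]
    nlinarith
  have h3 := abs_sub (ε * i) (i / r)
  nlinarith [sq_nonneg (s / 2 - C₀), sq_nonneg (s / 2 - 1 / ε), sq_nonneg x]

theorem exists_le_of_quadratic_growth {a₁ lam β₁ ε : ℝ} (ha₁ : 0 < a₁) (hlam : 1 ≤ lam)
    (hβ₁ : 1 ≤ β₁) (hε : 0 < ε) :
    ∃ C₀ : ℝ, 0 ≤ C₀ ∧ ∀ r y : ℝ, 0 < r → 1 ≤ y →
      (1 / a₁) * r ^ (lam + 1) - a₁ - a₁ * (1 + r + r ^ (-β₁)) ≤ y → r ≤ ε * y + C₀ := by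
  refine ⟨(1 + ε * a₁) ^ 2 * a₁ / (4 * ε) + 3 * ε * a₁ + 1, by positivity, ?_⟩
  intro r y hr hy h
  have hK : 0 ≤ (1 + ε * a₁) ^ 2 * a₁ / (4 * ε) := by positivity
  have hεa : 0 < ε * a₁ := by positivity
  rcases le_total r 1 with h1 | h1
  · nlinarith
  · have hB : r ^ (-β₁) ≤ 1 := Real.rpow_le_one_of_one_le_of_nonpos h1 (by linarith)
    have hA : r ^ 2 ≤ r ^ (lam + 1) := by
      rw [← Real.rpow_natCast]
      exact Real.rpow_le_rpow_of_exponent_le h1 (by push_cast; linarith)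
    have hq : r * (1 + ε * a₁) ≤ ε * ((1 / a₁) * r ^ 2) + (1 + ε * a₁) ^ 2 * a₁ / (4 * ε) := by
      have e : ε * ((1 / a₁) * r ^ 2) + (1 + ε * a₁) ^ 2 * a₁ / (4 * ε) - r * (1 + ε * a₁)
          = (2 * ε * r - (1 + ε * a₁) * a₁) ^ 2 / (4 * ε * a₁) := by
        field_simp; ring
      have : 0 ≤ (2 * ε * r - (1 + ε * a₁) * a₁) ^ 2 / (4 * ε * a₁) := by positivity
      linarith
    have hA' : ε * ((1 / a₁) * r ^ 2) ≤ ε * ((1 / a₁) * r ^ (lam + 1)) := by gcongr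
    have h' : ε * ((1 / a₁) * r ^ (lam + 1) - a₁ - a₁ * (1 + r + r ^ (-β₁))) ≤ ε * y := by gcongr
    have hB' : ε * a₁ * r ^ (-β₁) ≤ ε * a₁ * 1 := by gcongr
    nlinarith

/-- A linear drift `-c h + C` with `h ≍ √v` and a carré du champ of order `h²` give a
Lyapunov drift for every power of `v`. -/
theorem exists_power_drift {c C D M : ℝ} (hc : 0 < c) (hC : 0 < C) (hD : 0 ≤ D) (hM : 0 < M)
    {n : ℕ} (hn : 1 ≤ n) :
    ∃ c' C' : ℝ, 0 < c' ∧ 0 < C' ∧ ∀ v h L S : ℝ, 1 ≤ v → 0 ≤ h → h ^ 2 / 2 ≤ v →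
      v ≤ M * h ^ 2 → L ≤ -c * h + C → S ≤ D * h ^ 2 →
      n * v ^ (n - 1) * L + n * ((n - 1 : ℕ) * v ^ (n - 1 - 1)) * S
        ≤ -c' * v ^ ((n : ℝ) - 1 / 2) + C' := by
  have hn0 : (0 : ℝ) < n := by exact_mod_cast hn
  set c₁ := c / √M with hc₁
  set C₁ := C + 2 * D * n with hC₁
  have hc₁0 : 0 < c₁ := div_pos hc (Real.sqrt_pos.mpr hM)
  have hC₁0 : 0 < C₁ := by positivity
  refine ⟨n * (c₁ / 2), n * (C₁ * ((2 * C₁ / c₁) ^ 2) ^ (n - 1)), by positivity,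
    by positivity, ?_⟩
  intro v h L S hv hh hhv hvh hL hS
  have hv0 : 0 < v := by linarith
  have hw : √v ≤ √M * h := by
    calc √v ≤ √(M * h ^ 2) := Real.sqrt_le_sqrt hvh
      _ = √M * h := by rw [Real.sqrt_mul hM.le, Real.sqrt_sq hh]
  have hcw : c₁ * √v ≤ c * h := by
    rw [hc₁, div_mul_eq_mul_div, div_le_iff₀ (Real.sqrt_pos.mpr hM)]
    nlinarith
  have hcarre : ((n - 1 : ℕ) : ℝ) * v ^ (n - 1 - 1) * S ≤ v ^ (n - 1) * (2 * D * n) := by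
    rcases Nat.eq_zero_or_pos (n - 1) with h0 | h0
    · rw [h0]; simp; positivity
    · have e : v ^ (n - 1) = v ^ (n - 1 - 1) * v := by
        rw [← pow_succ]; congr 1; omega
      have hS' : S ≤ 2 * D * v := by nlinarith
      have hnn : ((n - 1 : ℕ) : ℝ) ≤ n := by exact_mod_cast Nat.sub_le n 1
      calc ((n - 1 : ℕ) : ℝ) * v ^ (n - 1 - 1) * S
          ≤ ((n - 1 : ℕ) : ℝ) * v ^ (n - 1 - 1) * (2 * D * v) := by gcongr
        _ ≤ n * v ^ (n - 1 - 1) * (2 * D * v) := by gcongr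
        _ = _ := by rw [e]; ring
  have hpow : v ^ ((n : ℝ) - 1 / 2) = v ^ (n - 1) * √v := by
    rw [Real.sqrt_eq_rpow, ← Real.rpow_natCast, ← Real.rpow_add hv0, Nat.cast_sub hn]
    congr 1
    push_cast
    ring
  have hmain : v ^ (n - 1) * (-c₁ * √v + C₁)
      ≤ -(c₁ / 2) * (v ^ (n - 1) * √v) + C₁ * ((2 * C₁ / c₁) ^ 2) ^ (n - 1) := by
    have hvn : 0 < v ^ (n - 1) := by positivity
    rcases le_total (2 * C₁ / c₁) √v with h1 | h1
    · rw [div_le_iff₀ hc₁0] at h1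
      have h2 : 0 ≤ C₁ * ((2 * C₁ / c₁) ^ 2) ^ (n - 1) := by positivity
      nlinarith
    · have h2 : v ≤ (2 * C₁ / c₁) ^ 2 := (Real.sqrt_le_left (by positivity)).mp h1
      have h3 : C₁ * v ^ (n - 1) ≤ C₁ * ((2 * C₁ / c₁) ^ 2) ^ (n - 1) := by gcongr
      have h4 : 0 ≤ c₁ * (v ^ (n - 1) * √v) := by positivity
      nlinarith
  rw [hpow]
  calc n * v ^ (n - 1) * L + n * ((n - 1 : ℕ) * v ^ (n - 1 - 1)) * S
      = n * (v ^ (n - 1) * L + (n - 1 : ℕ) * v ^ (n - 1 - 1) * S) := by ring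
    _ ≤ n * (v ^ (n - 1) * (-c₁ * √v + C) + v ^ (n - 1) * (2 * D * n)) := by
        gcongr; linarith
    _ = n * (v ^ (n - 1) * (-c₁ * √v + C₁)) := by rw [hC₁]; ring
    _ ≤ n * (-(c₁ / 2) * (v ^ (n - 1) * √v) + C₁ * ((2 * C₁ / c₁) ^ 2) ^ (n - 1)) := by gcongr
    _ = _ := by ring

end Scalar

section V1Bounds

variable {d : ℕ} {ε : ℝ} (κ₁ : ℝ) (U G : EuclideanSpace ℝ (Fin d) → ℝ)
  (q p : EuclideanSpace ℝ (Fin d))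

theorem sum_sq_fderiv_V1_momentum_le {q : EuclideanSpace ℝ (Fin d)} {s x C₀ : ℝ}
    (hε : 0 < ε) (hq : q ≠ 0)
    (hs : s = √(1 + ε * ‖p‖ ^ 2)) (hx : x = ε * U q + ε * G q) (hs1 : 1 ≤ s) (hx0 : 0 ≤ x)
    (hps : ε * ‖p‖ ≤ s) (hC₀ : 0 ≤ C₀) (hqx : ε * ‖q‖ ≤ x + C₀) :
    ∑ i : Fin d, fderiv ℝ (V1 ε κ₁ U G q) p (EuclideanSpace.single i 1) ^ 2
      ≤ (3 + C₀) ^ 2 * (x + s) ^ 2 := by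
  set g := (2 * ε * x / s + 2 * ε) • p + (ε - ‖q‖⁻¹) • q with hg
  have hs0 : 0 < s := by linarith
  have hn : 0 < ‖q‖ := norm_pos_iff.mpr hq
  have hsum : ∑ i : Fin d, fderiv ℝ (V1 ε κ₁ U G q) p (EuclideanSpace.single i 1) ^ 2
      = ‖g‖ ^ 2 := by
    rw [EuclideanSpace.real_norm_sq_eq]
    refine Finset.sum_congr rfl fun i _ => ?_
    rw [fderiv_V1_momentum κ₁ U G q p hε.le, ← hs, ← hx]
    simp only [EuclideanSpace.inner_single_right, hg, PiLp.add_apply, PiLp.smul_apply,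
      smul_eq_mul, conj_trivial]
    ring
  have h1 : ‖(2 * ε * x / s + 2 * ε) • p‖ ≤ 2 * (x + s) := by
    rw [norm_smul, Real.norm_of_nonneg (by positivity)]
    calc (2 * ε * x / s + 2 * ε) * ‖p‖ = 2 * (x / s + 1) * (ε * ‖p‖) := by ring
      _ ≤ 2 * (x / s + 1) * s := by gcongr
      _ = 2 * (x + s) := by field_simp
  have h2 : ‖(ε - ‖q‖⁻¹) • q‖ ≤ ε * ‖q‖ + 1 := by
    rw [sub_smul]
    refine (norm_sub_le _ _).trans ?_
    rw [norm_smul, norm_smul, norm_inv, norm_norm, inv_mul_cancel₀ hn.ne',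
      Real.norm_of_nonneg hε.le]
  have h3 : ‖g‖ ≤ (3 + C₀) * (x + s) := by
    have := norm_add_le ((2 * ε * x / s + 2 * ε) • p) ((ε - ‖q‖⁻¹) • q)
    nlinarith
  rw [hsum, ← mul_pow]
  gcongr

end V1Bounds

theorem potential_terms_le {d : ℕ} {U G : EuclideanSpace ℝ (Fin d) → ℝ}
    {q : EuclideanSpace ℝ (Fin d)} {ε a₁ lam a₂ a₃ β₁ β₂ a₄ a₅ a₆ : ℝ}
    (hr : 0 < ‖q‖) (hε : 0 ≤ ε) (hε1 : ε ≤ 1) (ha₃ : 0 ≤ a₃)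
    (hUgrad : ‖gradient U q‖ ≤ a₁ * (1 + ‖q‖ ^ lam))
    (hUcoer : a₂ * ‖q‖ ^ (lam + 1) - a₃ ≤ ⟪gradient U q, q⟫)
    (hGgradbd : ‖gradient G q‖ ≤ a₁ * (1 + ‖q‖ ^ (-β₁)))
    (hGstruct : ‖gradient G q + (a₄ / ‖q‖ ^ (β₁ + 1)) • q + (a₅ / ‖q‖ ^ (β₂ + 1)) • q‖ ≤ a₆) :
    -(ε * ⟪gradient U q, q⟫) - ε * ⟪gradient G q, q⟫
        + (⟪gradient U q, q⟫ / ‖q‖ + ⟪gradient G q, q⟫ / ‖q‖)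
      ≤ a₁ * ‖q‖ ^ lam + ε * (a₁ * (‖q‖ * (1 + ‖q‖ ^ (-β₁)))) + |a₅| * ‖q‖ ^ (-β₂)
        - ε * a₂ * ‖q‖ ^ (lam + 1) - a₄ * ‖q‖ ^ (-β₁) + (a₃ + a₁ + a₆) := by
  have hu1 : -(ε * ⟪gradient U q, q⟫) ≤ -(ε * a₂ * ‖q‖ ^ (lam + 1)) + a₃ := by
    nlinarith
  have hu2 : ⟪gradient U q, q⟫ / ‖q‖ ≤ a₁ * (1 + ‖q‖ ^ lam) := by
    rw [div_le_iff₀ hr]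
    calc _ ≤ ‖gradient U q‖ * ‖q‖ := real_inner_le_norm _ _
      _ ≤ _ := by gcongr
  have hg1 : -(ε * ⟪gradient G q, q⟫) ≤ ε * (a₁ * (‖q‖ * (1 + ‖q‖ ^ (-β₁)))) := by
    rw [← mul_neg, ← inner_neg_left]
    gcongr
    calc _ ≤ ‖-gradient G q‖ * ‖q‖ := real_inner_le_norm _ _
      _ ≤ a₁ * (1 + ‖q‖ ^ (-β₁)) * ‖q‖ := by
        rw [norm_neg]; gcongr
      _ = _ := by ring
  have hg2 : ⟪gradient G q, q⟫ / ‖q‖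
      ≤ a₆ + |a₅| * ‖q‖ ^ (-β₂) - a₄ * ‖q‖ ^ (-β₁) := by
    have hpw : ∀ a β : ℝ, ⟪(a / ‖q‖ ^ (β + 1)) • q, q⟫ = a * ‖q‖ ^ (-β) * ‖q‖ := by
      intro a β
      rw [real_inner_smul_left, real_inner_self_eq_norm_sq, Real.rpow_add_one hr.ne',
        Real.rpow_neg hr.le]
      field_simp
    have h := (real_inner_le_norm _ q).trans
      (mul_le_mul_of_nonneg_right hGstruct hr.le)
    rw [inner_add_left, inner_add_left, hpw, hpw] at h
    have h5 : -a₅ * (‖q‖ ^ (-β₂) * ‖q‖) ≤ |a₅| * (‖q‖ ^ (-β₂) * ‖q‖) := by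
      gcongr; exact neg_le_abs a₅
    rw [div_le_iff₀ hr]
    linarith
  linarith

/-- Size estimates for `H₁ = x + s`, split into its potential part `x` and kinetic part `s`. -/
theorem exists_H1_split {d : ℕ} {U G : EuclideanSpace ℝ (Fin d) → ℝ} {ε C₀ : ℝ}
    {q : EuclideanSpace ℝ (Fin d)} (p : EuclideanSpace ℝ (Fin d)) (hε : 0 < ε) (hε1 : ε ≤ 1)
    (hq : q ≠ 0) (hUG : 1 ≤ U q + G q) (hlin : ‖q‖ ≤ ε * (U q + G q) + C₀) :
    ∃ s x, s = √(1 + ε * ‖p‖ ^ 2) ∧ x = ε * U q + ε * G q ∧ 1 ≤ s ∧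
      s ^ 2 = 1 + ε * ‖p‖ ^ 2 ∧ 0 ≤ x ∧ ε * ‖p‖ ≤ s ∧ ‖q‖ ≤ x + C₀ ∧
      |⟪q, p⟫| ≤ ‖q‖ * ‖p‖ ∧
      |ε * ⟪q, p⟫ - ⟪q, p⟫ / ‖q‖| ≤ (x + s) ^ 2 / 2 + (C₀ ^ 2 + (1 / ε) ^ 2) := by
  have hn : 0 < ‖q‖ := norm_pos_iff.mpr hq
  have hs1 : 1 ≤ √(1 + ε * ‖p‖ ^ 2) := Real.one_le_sqrt.mpr (by nlinarith [sq_nonneg ‖p‖])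
  have hs2 : √(1 + ε * ‖p‖ ^ 2) ^ 2 = 1 + ε * ‖p‖ ^ 2 := Real.sq_sqrt (by positivity)
  have hps : ε * ‖p‖ ≤ √(1 + ε * ‖p‖ ^ 2) := by
    refine Real.le_sqrt_of_sq_le ?_
    have : ε * (ε * ‖p‖ ^ 2) ≤ 1 * (ε * ‖p‖ ^ 2) := by gcongr
    nlinarith
  have hqx : ‖q‖ ≤ ε * U q + ε * G q + C₀ := by linarith
  have hi := abs_real_inner_le_norm q p
  refine ⟨_, _, rfl, rfl, hs1, hs2, ?_, hps, hqx, hi, cross_term_le hε hn hs1 hi hps hqx⟩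
  rw [← mul_add]
  positivity

theorem V1_equiv_H1_sq {d : ℕ} {U G : EuclideanSpace ℝ (Fin d) → ℝ} {ε C₀ K : ℝ}
    {q : EuclideanSpace ℝ (Fin d)} (p : EuclideanSpace ℝ (Fin d)) (hε : 0 < ε) (hε1 : ε ≤ 1)
    (hq : q ≠ 0) (hUG : 1 ≤ U q + G q) (hlin : ‖q‖ ≤ ε * (U q + G q) + C₀)
    (hK : K = C₀ ^ 2 + (1 / ε) ^ 2) :
    1 ≤ H1 ε U G q p ∧ H1 ε U G q p ^ 2 / 2 + 1 ≤ V1 ε (K + 1) U G q p ∧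
      V1 ε (K + 1) U G q p ≤ (2 * K + 3) * H1 ε U G q p ^ 2 := by
  obtain ⟨s, x, hs, hx, hs1, -, hx0, -, -, -, hcross⟩ := exists_H1_split p hε hε1 hq hUG hlin
  have hHe : H1 ε U G q p = x + s := by rw [H1, ← hs, ← hx]
  have hK0 : 0 ≤ K := hK ▸ by positivity
  rw [← hK] at hcross
  obtain ⟨l, u⟩ := abs_le.mp hcross
  have h1 : 1 ≤ (x + s) ^ 2 := one_le_pow₀ (by linarith)
  rw [V1, hHe]
  refine ⟨by linarith, by linarith, ?_⟩
  nlinarith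

/-- Lemma 3.1: under Assumptions (U) and (G1) and the normalization `U + G ≥ 1`,
there exists `ε₀ ∈ (0,1)` such that for every `ε ∈ (0,ε₀)` there is `κ₁ > 0` with
`V₁ ≥ 1` everywhere, and for every `n ≥ 1` there are `c, C > 0` with
`L₁(V₁ⁿ) ≤ −c V₁^{n−1/2} + C` on `(ℝ^d ∖ {0}) × ℝ^d`. -/
theorem stmt_12 (d : ℕ) (hd : 1 ≤ d)
    (U G : EuclideanSpace ℝ (Fin d) → ℝ)
    (a₁ lam a₂ a₃ β₁ β₂ a₄ a₅ a₆ : ℝ)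
    (ha₁ : 0 < a₁) (hlam : 1 ≤ lam) (ha₂ : 0 < a₂) (ha₃ : 0 < a₃)
    (hβ₁ : 1 ≤ β₁) (hβ₂0 : 0 ≤ β₂) (hβ₂1 : β₂ < β₁) (ha₄ : 0 < a₄) (ha₆ : 0 < a₆)
    (hUsmooth : ContDiff ℝ (⊤ : ℕ∞) U)
    (hUone : ∀ q, 1 ≤ U q)
    (hUlow : ∀ q : EuclideanSpace ℝ (Fin d), (1 / a₁) * ‖q‖ ^ (lam + 1) - a₁ ≤ U q)
    (hUup : ∀ q : EuclideanSpace ℝ (Fin d), U q ≤ a₁ * (1 + ‖q‖ ^ (lam + 1)))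
    (hUgrad : ∀ q : EuclideanSpace ℝ (Fin d), ‖gradient U q‖ ≤ a₁ * (1 + ‖q‖ ^ lam))
    (hUcoer : ∀ q : EuclideanSpace ℝ (Fin d), a₂ * ‖q‖ ^ (lam + 1) - a₃ ≤ ⟪gradient U q, q⟫)
    (hGsmooth : ContDiffOn ℝ (⊤ : ℕ∞) G {(0 : EuclideanSpace ℝ (Fin d))}ᶜ)
    (hGblow : Filter.Tendsto G (nhdsWithin 0 {(0 : EuclideanSpace ℝ (Fin d))}ᶜ) Filter.atTop)
    (hGeven : ∀ q, G (-q) = G q)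
    (hGodd : ∀ q : EuclideanSpace ℝ (Fin d), q ≠ 0 → gradient G (-q) = -gradient G q)
    (hGbd : ∀ q : EuclideanSpace ℝ (Fin d), q ≠ 0 →
      |G q| ≤ a₁ * (1 + ‖q‖ + ‖q‖ ^ (-β₁)))
    (hGgradbd : ∀ q : EuclideanSpace ℝ (Fin d), q ≠ 0 →
      ‖gradient G q‖ ≤ a₁ * (1 + ‖q‖ ^ (-β₁)))
    (hGstruct : ∀ q : EuclideanSpace ℝ (Fin d), q ≠ 0 →
      ‖gradient G q + (a₄ / ‖q‖ ^ (β₁ + 1)) • q + (a₅ / ‖q‖ ^ (β₂ + 1)) • q‖ ≤ a₆)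
    (hUG : ∀ q : EuclideanSpace ℝ (Fin d), q ≠ 0 → 1 ≤ U q + G q) :
    ∃ ε₀ : ℝ, ε₀ ∈ Set.Ioo (0 : ℝ) 1 ∧
      ∀ ε : ℝ, ε ∈ Set.Ioo (0 : ℝ) ε₀ →
        ∃ κ₁ : ℝ, 0 < κ₁ ∧
          (∀ q : EuclideanSpace ℝ (Fin d), q ≠ 0 → ∀ p : EuclideanSpace ℝ (Fin d),
            1 ≤ V1 ε κ₁ U G q p) ∧
          (∀ n : ℕ, 1 ≤ n →
            ∃ c C : ℝ, 0 < c ∧ 0 < C ∧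
              ∀ q : EuclideanSpace ℝ (Fin d), q ≠ 0 → ∀ p : EuclideanSpace ℝ (Fin d),
                L1 ε U G (fun q' p' => (V1 ε κ₁ U G q' p') ^ n) q p
                  ≤ -c * (V1 ε κ₁ U G q p) ^ ((n : ℝ) - 1 / 2) + C) := by
  have hd0 : (0 : ℝ) < d := by exact_mod_cast hd
  have hε₀ : 0 < min (1 / 2) (min (a₂ / (4 * d * a₁)) (a₄ / (4 * d * a₁))) := by positivity
  refine ⟨min (1 / 2) (min (a₂ / (4 * d * a₁)) (a₄ / (4 * d * a₁))),
    ⟨hε₀, (min_le_left _ _).trans_lt (by norm_num)⟩, ?_⟩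
  rintro ε ⟨hε, hεlt⟩
  obtain ⟨hε2, hεlt'⟩ := lt_min_iff.mp hεlt
  obtain ⟨hεa₂, hεa₄⟩ := lt_min_iff.mp hεlt'
  have hε1 : ε ≤ 1 := by linarith
  have h₂ : 4 * d * a₁ * ε ≤ a₂ := by
    rw [lt_div_iff₀ (by positivity)] at hεa₂; linarith
  have h₄ : 4 * d * a₁ * ε ≤ a₄ := by
    rw [lt_div_iff₀ (by positivity)] at hεa₄; linarith
  obtain ⟨C₀, hC₀, hlin⟩ := exists_le_of_quadratic_growth ha₁ hlam hβ₁ hε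
  obtain ⟨c, C, hc, hC, hdis⟩ := exists_dissipation a₅
    (1 + 2 * ε * d + 1 / ε + a₃ + a₁ + a₆) ha₁ hlam ha₂ hβ₁ hβ₂0 hβ₂1 ha₄ hε hε1 hd0.le h₂ h₄
  obtain ⟨K, hK⟩ : ∃ K, K = C₀ ^ 2 + (1 / ε) ^ 2 := ⟨_, rfl⟩
  have hK0 : 0 ≤ K := hK ▸ by positivity
  have hqx : ∀ q : EuclideanSpace ℝ (Fin d), q ≠ 0 → ‖q‖ ≤ ε * (U q + G q) + C₀ := fun q hq =>
    hlin ‖q‖ (U q + G q) (norm_pos_iff.mpr hq) (hUG q hq)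
      (by linarith [hUlow q, (abs_le.mp (hGbd q hq)).1])
  refine ⟨K + 1, by positivity, fun q hq p => ?_, fun n hn => ?_⟩
  · obtain ⟨-, h, -⟩ := V1_equiv_H1_sq p hε hε1 hq (hUG q hq) (hqx q hq) hK
    nlinarith [sq_nonneg (H1 ε U G q p)]
  obtain ⟨c', C', hc', hC', hpow⟩ := exists_power_drift (D := (3 + C₀) ^ 2) (M := 2 * K + 3)
    hc hC (by positivity) (by positivity) hn
  refine ⟨c', C', hc', hC', fun q hq p => ?_⟩
  obtain ⟨hH1, hVlow, hVup⟩ := V1_equiv_H1_sq p hε hε1 hq (hUG q hq) (hqx q hq) hK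
  obtain ⟨s, x, hs, hx, hs1, hs2, hx0, hps, hqx', hi, -⟩ :=
    exists_H1_split p hε hε1 hq (hUG q hq) (hqx q hq)
  have hHe : H1 ε U G q p = x + s := by rw [H1, ← hs, ← hx]
  have hr : 0 < ‖q‖ := norm_pos_iff.mpr hq
  have hUd : DifferentiableAt ℝ U q := hUsmooth.differentiable (by simp) q
  have hGd : DifferentiableAt ℝ G q :=
    (hGsmooth.differentiableOn (by simp)).differentiableAt (isOpen_compl_singleton.mem_nhds hq)
  rw [L1_pow ε U G (V1 ε (K + 1) U G) q p
    (hasFDerivAt_V1_position (K + 1) U G p hq hUd hGd).differentiableAt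
    (contDiff_V1_momentum (K + 1) U G q hε.le)]
  refine hpow _ (H1 ε U G q p) _ _ (by nlinarith [sq_nonneg (H1 ε U G q p)]) (by linarith)
    (by linarith) hVup ?_ ?_
  · rw [L1_V1 (K + 1) U G p hε.le hq hUd hGd hs hx, hHe]
    refine (drift_le hε hr hs1 hs2 hx0 hd0.le hi hps).trans (le_trans ?_ (hdis ‖q‖ s x hr hs1 ?_))
    · have h := potential_terms_le hr hε.le hε1 ha₃.le (hUgrad q) (hUcoer q) (hGgradbd q hq)
        (hGstruct q hq)
      linarith
    · rw [hx, ← mul_add]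
      gcongr
      · exact hUup q
      · exact (le_abs_self _).trans (hGbd q hq)
  · rw [hHe]
    exact sum_sq_fderiv_V1_momentum_le (K + 1) U G p hε hq hs hx hs1 hx0 hps hC₀
      ((mul_le_of_le_one_left hr.le hε1).trans hqx')
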